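/- Let N ≥ 3. There exist constants C > 0, R₀ ≥ 1 and λ₀ ∈ (0,1) (depending only on N) such that for all R ≥ R₀ and all λ₁, λ₂ > 0 with λ := λ₁/λ₂ ≤ λ₀, the truncated bubble V_R(λ₁,λ₂) satisfies: (i) (∫_{ℝ^N} |∇(V_R(λ₁,λ₂) − W_{λ₁})|² dx)^{1/2} ≤ C R^{-(N−2)/2} λ^{(N−2)/4}; (ii) sup_{x∈ℝ^N} |V_R(λ₁,λ₂)(x) − W_{λ₁}(x)| ≤ C R^{-(N−2)} λ₂^{-(N−2)/2}; (iii) ∫_{ℝ^N} |V_R(λ₁,λ₂)(x)| dx ≤ C R² λ₂^{(N+2)/2} λ^{N/2}. -/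

import Mathlib

open MeasureTheory Real

noncomputable def groundW (N : ℕ) (x : EuclideanSpace ℝ (Fin N)) : ℝ :=
  (1 + ‖x‖ ^ 2 / ((N : ℝ) * ((N : ℝ) - 2))) ^ (-(((N : ℝ) - 2) / 2))

/-- The rescaled ground state `W_λ`. -/
noncomputable def Wl (N : ℕ) (lam : ℝ) (x : EuclideanSpace ℝ (Fin N)) : ℝ :=
  lam ^ (-(((N : ℝ) - 2) / 2)) * groundW N (lam⁻¹ • x)

/-- The constant `ζ(λ₁, λ₂)`, equal to the value of `W_{λ₁}` on `|x| = R√(λ₁λ₂)`. -/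
noncomputable def zeta (N : ℕ) (R l1 l2 : ℝ) : ℝ :=
  (l1 + R ^ 2 * l2 / ((N : ℝ) * ((N : ℝ) - 2))) ^ (-(((N : ℝ) - 2) / 2))

/-- The truncated bubble `V_R(λ₁, λ₂)`. -/
noncomputable def VR (N : ℕ) (R l1 l2 : ℝ) (x : EuclideanSpace ℝ (Fin N)) : ℝ :=
  if ‖x‖ ≤ R * Real.sqrt (l1 * l2) then Wl N l1 x - zeta N R l1 l2 else 0

section RadialIntegrals

variable {N : ℕ}

/-- The area of the unit sphere in `ℝ^N`. -/
noncomputable def sphereArea (N : ℕ) : ℝ :=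
  N * volume.real (Metric.ball (0 : EuclideanSpace ℝ (Fin N)) 1)

lemma sphereArea_nonneg (N : ℕ) : 0 ≤ sphereArea N := by
  unfold sphereArea; positivity

lemma nontrivial_euclideanSpace (hN : 3 ≤ N) : Nontrivial (EuclideanSpace ℝ (Fin N)) := by
  apply Module.nontrivial_of_finrank_pos (R := ℝ)
  rw [finrank_euclideanSpace_fin]; omega

lemma integral_radial (hN : 3 ≤ N) (f : ℝ → ℝ) :
    ∫ x : EuclideanSpace ℝ (Fin N), f ‖x‖ =
      sphereArea N * ∫ r in Set.Ioi (0 : ℝ), r ^ (N - 1) * f r := by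
  have := nontrivial_euclideanSpace hN
  rw [integral_fun_norm_addHaar, finrank_euclideanSpace_fin]
  simp [sphereArea, mul_assoc]

lemma integrable_radial (hN : 3 ≤ N) (f : ℝ → ℝ) :
    Integrable (fun x : EuclideanSpace ℝ (Fin N) => f ‖x‖) ↔
      IntegrableOn (fun r => r ^ (N - 1) * f r) (Set.Ioi (0 : ℝ)) := by
  have := nontrivial_euclideanSpace hN
  rw [integrable_fun_norm_addHaar, finrank_euclideanSpace_fin]
  simp

lemma pow_mul_rpow_eq {r : ℝ} (hr : 0 < r) (hN : 3 ≤ N) (s : ℝ) :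
    r ^ (N - 1) * r ^ s = r ^ ((N : ℝ) - 1 + s) := by
  rw [← rpow_natCast, ← rpow_add hr, Nat.cast_sub (by omega), Nat.cast_one]

lemma eqOn_inner_profile (hN : 3 ≤ N) (ρ : ℝ) :
    Set.EqOn (fun r : ℝ => r ^ (N - 1) * (Set.Iic ρ).indicator (fun t => t ^ (-((N : ℝ) - 2))) r)
      ((Set.Iic ρ).indicator fun r => r) (Set.Ioi 0) := by
  intro r hr
  by_cases h : r ∈ Set.Iic ρ
  · simp only [Set.indicator_of_mem h, pow_mul_rpow_eq hr hN]
    rw [show (N : ℝ) - 1 + -((N : ℝ) - 2) = 1 by ring, rpow_one]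
  · simp [Set.indicator_of_notMem h]

lemma integrable_inner_profile (hN : 3 ≤ N) (ρ : ℝ) :
    Integrable (fun x : EuclideanSpace ℝ (Fin N) =>
      (Set.Iic ρ).indicator (fun t => t ^ (-((N : ℝ) - 2))) ‖x‖) := by
  rw [integrable_radial hN, integrableOn_congr_fun (eqOn_inner_profile hN ρ) measurableSet_Ioi,
    integrableOn_indicator_iff measurableSet_Iic, Set.inter_comm, Set.Ioi_inter_Iic]
  exact (continuous_id.integrableOn_Icc).mono_set Set.Ioc_subset_Icc_self

lemma integral_inner_profile (hN : 3 ≤ N) {ρ : ℝ} (hρ : 0 ≤ ρ) :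
    ∫ x : EuclideanSpace ℝ (Fin N), (Set.Iic ρ).indicator (fun t => t ^ (-((N : ℝ) - 2))) ‖x‖ =
      sphereArea N * (ρ ^ 2 / 2) := by
  rw [integral_radial hN, setIntegral_congr_fun measurableSet_Ioi (eqOn_inner_profile hN ρ),
    setIntegral_indicator measurableSet_Iic, Set.Ioi_inter_Iic,
    ← intervalIntegral.integral_of_le hρ, integral_id]
  simp

lemma eqOn_outer_profile (hN : 3 ≤ N) (ρ : ℝ) :
    Set.EqOn
      (fun r : ℝ => r ^ (N - 1) * (Set.Ioi ρ).indicator (fun t => t ^ (-(2 * ((N : ℝ) - 1)))) r)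
      ((Set.Ioi ρ).indicator fun r => r ^ (-((N : ℝ) - 1))) (Set.Ioi 0) := by
  intro r hr
  by_cases h : r ∈ Set.Ioi ρ
  · simp only [Set.indicator_of_mem h, pow_mul_rpow_eq hr hN]
    congr 1; ring
  · simp [Set.indicator_of_notMem h]

lemma integrable_outer_profile (hN : 3 ≤ N) {ρ : ℝ} (hρ : 0 < ρ) :
    Integrable (fun x : EuclideanSpace ℝ (Fin N) =>
      (Set.Ioi ρ).indicator (fun t => t ^ (-(2 * ((N : ℝ) - 1)))) ‖x‖) := by
  have hN' : (3 : ℝ) ≤ N := by exact_mod_cast hN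
  rw [integrable_radial hN, integrableOn_congr_fun (eqOn_outer_profile hN ρ) measurableSet_Ioi,
    integrableOn_indicator_iff measurableSet_Ioi]
  exact (integrableOn_Ioi_rpow_of_lt (by linarith) hρ).mono_set Set.inter_subset_left

lemma integral_outer_profile (hN : 3 ≤ N) {ρ : ℝ} (hρ : 0 < ρ) :
    ∫ x : EuclideanSpace ℝ (Fin N),
        (Set.Ioi ρ).indicator (fun t => t ^ (-(2 * ((N : ℝ) - 1)))) ‖x‖ =
      sphereArea N * (ρ ^ (-((N : ℝ) - 2)) / ((N : ℝ) - 2)) := by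
  have hN' : (3 : ℝ) ≤ N := by exact_mod_cast hN
  rw [integral_radial hN, setIntegral_congr_fun measurableSet_Ioi (eqOn_outer_profile hN ρ),
    setIntegral_indicator measurableSet_Ioi, Set.Ioi_inter_Ioi, sup_eq_right.mpr hρ.le,
    integral_Ioi_rpow_of_lt (by linarith) hρ,
    show -((N : ℝ) - 1) + 1 = -((N : ℝ) - 2) by ring, neg_div_neg_eq]

end RadialIntegrals

section Bubble

variable {N : ℕ}

lemma bubble_denominator_pos (hN : 3 ≤ N) : 0 < (N : ℝ) * ((N : ℝ) - 2) := by
  have hN' : (3 : ℝ) ≤ N := by exact_mod_cast hN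
  exact mul_pos (by linarith) (by linarith)

lemma Wl_eq (hN : 3 ≤ N) {l : ℝ} (hl : 0 < l) (x : EuclideanSpace ℝ (Fin N)) :
    Wl N l x =
      (l + ‖x‖ ^ 2 / (l * ((N : ℝ) * ((N : ℝ) - 2)))) ^ (-(((N : ℝ) - 2) / 2)) := by
  have hK := bubble_denominator_pos hN
  unfold Wl groundW
  rw [← mul_rpow hl.le (by positivity), norm_smul, norm_inv, norm_of_nonneg hl.le]
  congr 1
  field_simp

lemma profile_rpow_neg_le (hN : 3 ≤ N) {l p : ℝ} (hl : 0 < l) (hp : 0 ≤ p)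
    {x : EuclideanSpace ℝ (Fin N)} (hx : x ≠ 0) :
    (l + ‖x‖ ^ 2 / (l * ((N : ℝ) * ((N : ℝ) - 2)))) ^ (-p) ≤
      (l * ((N : ℝ) * ((N : ℝ) - 2))) ^ p * ‖x‖ ^ (-(2 * p)) := by
  have hK := bubble_denominator_pos hN
  have hn : 0 < ‖x‖ := norm_pos_iff.mpr hx
  calc
    _ ≤ (‖x‖ ^ 2 / (l * ((N : ℝ) * ((N : ℝ) - 2)))) ^ (-p) :=
      rpow_le_rpow_of_nonpos (by positivity) (by linarith) (by linarith)
    _ = _ := by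
      rw [div_rpow (by positivity) (by positivity), rpow_neg (x := l * _) (by positivity),
        div_inv_eq_mul, mul_comm, ← rpow_natCast ‖x‖ 2, ← rpow_mul hn.le]
      push_cast
      ring_nf

lemma Wl_nonneg (hN : 3 ≤ N) {l : ℝ} (hl : 0 < l) (x : EuclideanSpace ℝ (Fin N)) :
    0 ≤ Wl N l x := by
  have hK := bubble_denominator_pos hN
  rw [Wl_eq hN hl]; positivity

lemma zeta_nonneg (hN : 3 ≤ N) {l1 l2 : ℝ} (R : ℝ) (h1 : 0 < l1) (h2 : 0 < l2) :
    0 ≤ zeta N R l1 l2 := by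
  have hK := bubble_denominator_pos hN
  unfold zeta; positivity

lemma zeta_le (hN : 3 ≤ N) {R l1 l2 : ℝ} (hR : 0 < R) (h1 : 0 < l1) (h2 : 0 < l2) :
    zeta N R l1 l2 ≤ ((N : ℝ) * ((N : ℝ) - 2)) ^ (((N : ℝ) - 2) / 2) *
      R ^ (-((N : ℝ) - 2)) * l2 ^ (-(((N : ℝ) - 2) / 2)) := by
  have hK := bubble_denominator_pos hN
  have hN' : (3 : ℝ) ≤ N := by exact_mod_cast hN
  unfold zeta
  calc
    _ ≤ (R ^ 2 * l2 / ((N : ℝ) * ((N : ℝ) - 2))) ^ (-(((N : ℝ) - 2) / 2)) :=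
      rpow_le_rpow_of_nonpos (by positivity) (by linarith) (by linarith)
    _ = _ := by
      rw [div_rpow (by positivity) (by positivity),
        rpow_neg (x := (N : ℝ) * ((N : ℝ) - 2)) (by positivity), div_inv_eq_mul,
        mul_rpow (by positivity) h2.le, ← rpow_natCast R 2, ← rpow_mul hR.le]
      push_cast
      ring_nf

lemma sq_truncation_radius {R l1 l2 : ℝ} (h1 : 0 < l1) (h2 : 0 < l2) :
    (R * √(l1 * l2)) ^ 2 = R ^ 2 * (l1 * l2) := by
  rw [mul_pow, sq_sqrt (by positivity)]

lemma zeta_le_Wl (hN : 3 ≤ N) {R l1 l2 : ℝ} (h1 : 0 < l1) (h2 : 0 < l2)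
    {x : EuclideanSpace ℝ (Fin N)} (hx : ‖x‖ ≤ R * √(l1 * l2)) :
    zeta N R l1 l2 ≤ Wl N l1 x := by
  have hK := bubble_denominator_pos hN
  have hN' : (3 : ℝ) ≤ N := by exact_mod_cast hN
  rw [Wl_eq hN h1, zeta]
  refine rpow_le_rpow_of_nonpos (by positivity) ?_ (by linarith)
  have : ‖x‖ ^ 2 ≤ R ^ 2 * (l1 * l2) := by
    rw [← sq_truncation_radius h1 h2]; gcongr
  gcongr l1 + ?_
  calc _ ≤ R ^ 2 * (l1 * l2) / (l1 * ((N : ℝ) * ((N : ℝ) - 2))) := by gcongr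
    _ = _ := by field_simp

lemma Wl_le_zeta (hN : 3 ≤ N) {R l1 l2 : ℝ} (hR : 0 < R) (h1 : 0 < l1) (h2 : 0 < l2)
    {x : EuclideanSpace ℝ (Fin N)} (hx : R * √(l1 * l2) ≤ ‖x‖) :
    Wl N l1 x ≤ zeta N R l1 l2 := by
  have hK := bubble_denominator_pos hN
  have hN' : (3 : ℝ) ≤ N := by exact_mod_cast hN
  rw [Wl_eq hN h1, zeta]
  refine rpow_le_rpow_of_nonpos (by positivity) ?_ (by linarith)
  have : R ^ 2 * (l1 * l2) ≤ ‖x‖ ^ 2 := by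
    rw [← sq_truncation_radius h1 h2]; gcongr
  gcongr l1 + ?_
  calc _ = R ^ 2 * (l1 * l2) / (l1 * ((N : ℝ) * ((N : ℝ) - 2))) := by field_simp
    _ ≤ _ := by gcongr

lemma abs_VR_sub_Wl_le (hN : 3 ≤ N) {R l1 l2 : ℝ} (hR : 0 < R) (h1 : 0 < l1) (h2 : 0 < l2)
    (x : EuclideanSpace ℝ (Fin N)) : |VR N R l1 l2 x - Wl N l1 x| ≤ zeta N R l1 l2 := by
  unfold VR
  split_ifs with h
  · rw [sub_sub_cancel_left, abs_neg, abs_of_nonneg (zeta_nonneg hN R h1 h2)]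
  · rw [zero_sub, abs_neg, abs_of_nonneg (Wl_nonneg hN h1 x)]
    exact Wl_le_zeta hN hR h1 h2 (not_le.mp h).le

lemma abs_VR_le (hN : 3 ≤ N) {R l1 l2 : ℝ} (h1 : 0 < l1) (h2 : 0 < l2)
    {x : EuclideanSpace ℝ (Fin N)} (hx : x ≠ 0) :
    |VR N R l1 l2 x| ≤ (l1 * ((N : ℝ) * ((N : ℝ) - 2))) ^ (((N : ℝ) - 2) / 2) *
      (Set.Iic (R * √(l1 * l2))).indicator (fun t => t ^ (-((N : ℝ) - 2))) ‖x‖ := by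
  have hN' : (3 : ℝ) ≤ N := by exact_mod_cast hN
  unfold VR
  split_ifs with h
  · rw [Set.indicator_of_mem (Set.mem_Iic.mpr h),
      abs_of_nonneg (sub_nonneg.mpr (zeta_le_Wl hN h1 h2 h))]
    have hW := profile_rpow_neg_le (p := ((N : ℝ) - 2) / 2) hN h1 (by linarith) hx
    rw [← Wl_eq hN h1, mul_div_cancel₀ _ two_ne_zero] at hW
    linarith [zeta_nonneg hN R h1 h2]
  · simp [Set.indicator_of_notMem (show ‖x‖ ∉ Set.Iic (R * √(l1 * l2)) from h)]

lemma norm_fderiv_Wl_le (hN : 3 ≤ N) {l : ℝ} (hl : 0 < l)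
    {x : EuclideanSpace ℝ (Fin N)} (hx : x ≠ 0) :
    ‖fderiv ℝ (Wl N l) x‖ ≤ ((N : ℝ) - 2) *
      (l * ((N : ℝ) * ((N : ℝ) - 2))) ^ (((N : ℝ) - 2) / 2) * ‖x‖ ^ (-((N : ℝ) - 1)) := by
  have hK := bubble_denominator_pos hN
  have hN' : (3 : ℝ) ≤ N := by exact_mod_cast hN
  have hn : 0 < ‖x‖ := norm_pos_iff.mpr hx
  set M := l * ((N : ℝ) * ((N : ℝ) - 2)) with hM
  have hM0 : 0 < M := by positivity
  have hW : Wl N l = fun y => (l + ‖y‖ ^ 2 * M⁻¹) ^ (-(((N : ℝ) - 2) / 2)) := by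
    funext y; rw [Wl_eq hN hl, div_eq_mul_inv]
  have hd : HasFDerivAt (fun y : EuclideanSpace ℝ (Fin N) => l + ‖y‖ ^ 2 * M⁻¹)
      (M⁻¹ • (2 • innerSL ℝ x)) x :=
    ((hasStrictFDerivAt_norm_sq x).hasFDerivAt.mul_const M⁻¹).const_add l
  rw [hW, (hd.rpow_const (Or.inl (by positivity))).fderiv, norm_smul, norm_smul,
    ← Nat.cast_smul_eq_nsmul ℝ, norm_smul, innerSL_apply_norm, norm_mul]
  have hp := profile_rpow_neg_le (p := ((N : ℝ) - 2) / 2 + 1) hN hl (by linarith) hx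
  rw [← hM, div_eq_mul_inv, rpow_add hM0, rpow_one, neg_add] at hp
  have e1 : ‖-(((N : ℝ) - 2) / 2)‖ = ((N : ℝ) - 2) / 2 := by
    rw [norm_neg, norm_of_nonneg (by linarith)]
  rw [e1, norm_of_nonneg (by positivity), norm_of_nonneg (by positivity),
    norm_of_nonneg (by positivity), sub_eq_add_neg _ (1 : ℝ)]
  have e2 : ‖x‖ ^ (-((N : ℝ) - 1)) = ‖x‖ ^ (-(2 * (((N : ℝ) - 2) / 2 + 1))) * ‖x‖ := by
    rw [← rpow_add_one hn.ne']; congr 1; ring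
  rw [e2]
  push_cast
  calc
    _ ≤ ((N : ℝ) - 2) / 2 * (M ^ (((N : ℝ) - 2) / 2) * M *
        ‖x‖ ^ (-(2 * (((N : ℝ) - 2) / 2 + 1)))) * (M⁻¹ * (2 * ‖x‖)) := by
      gcongr
      linarith
    _ = _ := by field_simp

lemma sq_norm_fderiv_VR_sub_Wl_le (hN : 3 ≤ N) {R l1 l2 : ℝ} (hR : 0 < R) (h1 : 0 < l1)
    (h2 : 0 < l2) {x : EuclideanSpace ℝ (Fin N)} (hx : ‖x‖ ≠ R * √(l1 * l2)) :
    ‖fderiv ℝ (fun y => VR N R l1 l2 y - Wl N l1 y) x‖ ^ 2 ≤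
      (((N : ℝ) - 2) ^ 2 * (l1 * ((N : ℝ) * ((N : ℝ) - 2))) ^ ((N : ℝ) - 2)) *
      (Set.Ioi (R * √(l1 * l2))).indicator (fun t => t ^ (-(2 * ((N : ℝ) - 1)))) ‖x‖ := by
  have hK := bubble_denominator_pos hN
  have hρ : 0 < R * √(l1 * l2) := by positivity
  rcases lt_or_gt_of_ne hx with h | h
  · have heq : (fun y => VR N R l1 l2 y - Wl N l1 y) =ᶠ[nhds x] fun _ => -zeta N R l1 l2 := by
      filter_upwards [(isOpen_lt continuous_norm continuous_const).mem_nhds h] with y hy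
      simp [VR, if_pos (show ‖y‖ ≤ R * √(l1 * l2) from le_of_lt hy)]
    rw [heq.fderiv_eq, Set.indicator_of_notMem (by simpa using h.le)]
    simp
  · have heq : (fun y => VR N R l1 l2 y - Wl N l1 y) =ᶠ[nhds x] fun y => -Wl N l1 y := by
      filter_upwards [(isOpen_lt continuous_const continuous_norm).mem_nhds h] with y hy
      simp [VR, if_neg (show ¬ ‖y‖ ≤ R * √(l1 * l2) from not_le.mpr hy)]
    have hn : 0 < ‖x‖ := hρ.trans h
    rw [heq.fderiv_eq, fderiv_fun_neg, norm_neg, Set.indicator_of_mem (Set.mem_Ioi.mpr h)]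
    refine (pow_le_pow_left₀ (norm_nonneg _)
      (norm_fderiv_Wl_le hN h1 (norm_pos_iff.mp hn)) 2).trans_eq ?_
    rw [mul_pow, mul_pow, ← rpow_mul_natCast hn.le, ← rpow_mul_natCast (by positivity)]
    push_cast
    ring_nf

lemma integral_abs_VR_le (hN : 3 ≤ N) {R l1 l2 : ℝ} (hR : 0 < R) (h1 : 0 < l1) (h2 : 0 < l2) :
    ∫ x, |VR N R l1 l2 x| ≤
      (l1 * ((N : ℝ) * ((N : ℝ) - 2))) ^ (((N : ℝ) - 2) / 2) *
        (sphereArea N * (R ^ 2 * (l1 * l2) / 2)) := by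
  have := nontrivial_euclideanSpace hN
  rw [← sq_truncation_radius h1 h2, ← integral_inner_profile hN (by positivity),
    ← integral_const_mul]
  refine integral_mono_of_nonneg (ae_of_all _ fun x => abs_nonneg _)
    ((integrable_inner_profile hN _).const_mul _) ?_
  filter_upwards [compl_mem_ae_iff.mpr
    (measure_singleton (μ := volume) (0 : EuclideanSpace ℝ (Fin N)))] with x hx
  exact abs_VR_le hN h1 h2 hx

lemma integral_sq_norm_fderiv_le (hN : 3 ≤ N) {R l1 l2 : ℝ} (hR : 0 < R) (h1 : 0 < l1)
    (h2 : 0 < l2) :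
    ∫ x, ‖fderiv ℝ (fun y => VR N R l1 l2 y - Wl N l1 y) x‖ ^ 2 ≤
      (((N : ℝ) - 2) ^ 2 * (l1 * ((N : ℝ) * ((N : ℝ) - 2))) ^ ((N : ℝ) - 2)) *
        (sphereArea N * ((R * √(l1 * l2)) ^ (-((N : ℝ) - 2)) / ((N : ℝ) - 2))) := by
  have := nontrivial_euclideanSpace hN
  have hρ : 0 < R * √(l1 * l2) := by positivity
  rw [← integral_outer_profile hN hρ, ← integral_const_mul]
  refine integral_mono_of_nonneg (ae_of_all _ fun x => by positivity)
    ((integrable_outer_profile hN hρ).const_mul _) ?_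
  filter_upwards [compl_mem_ae_iff.mpr
    (Measure.addHaar_sphere volume (0 : EuclideanSpace ℝ (Fin N)) (R * √(l1 * l2)))] with x hx
  exact sq_norm_fderiv_VR_sub_Wl_le hN hR h1 h2 (by simpa using hx)

lemma sqrt_integral_sq_norm_fderiv_le (hN : 3 ≤ N) {R l1 l2 : ℝ} (hR : 0 < R) (h1 : 0 < l1)
    (h2 : 0 < l2) :
    √(∫ x, ‖fderiv ℝ (fun y => VR N R l1 l2 y - Wl N l1 y) x‖ ^ 2) ≤
      √(((N : ℝ) - 2) * ((N : ℝ) * ((N : ℝ) - 2)) ^ ((N : ℝ) - 2) * sphereArea N) *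
        R ^ (-(((N : ℝ) - 2) / 2)) * (l1 / l2) ^ (((N : ℝ) - 2) / 4) := by
  have hK := bubble_denominator_pos hN
  have hN' : (3 : ℝ) ≤ N := by exact_mod_cast hN
  have hm : 0 < (N : ℝ) - 2 := by linarith
  have hA := sphereArea_nonneg N
  rw [sqrt_le_left (by positivity)]
  refine (integral_sq_norm_fderiv_le hN hR h1 h2).trans_eq ?_
  rw [mul_pow, mul_pow, sq_sqrt (by positivity), ← rpow_mul_natCast hR.le,
    ← rpow_mul_natCast (by positivity), mul_rpow h1.le hK.le, mul_rpow hR.le (by positivity),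
    sqrt_eq_rpow, ← rpow_mul (by positivity), mul_rpow h1.le h2.le, div_rpow h1.le h2.le]
  have e1 : l1 ^ ((N : ℝ) - 2) =
      l1 ^ (((N : ℝ) - 2) / 2) * l1 ^ (((N : ℝ) - 2) / 2) := by
    rw [← rpow_add h1]; ring_nf
  rw [show -(((N : ℝ) - 2) / 2) * ((2 : ℕ) : ℝ) = -((N : ℝ) - 2) by push_cast; ring,
    show ((N : ℝ) - 2) / 4 * ((2 : ℕ) : ℝ) = ((N : ℝ) - 2) / 2 by push_cast; ring,
    show 1 / 2 * -((N : ℝ) - 2) = -(((N : ℝ) - 2) / 2) by ring, e1,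
    rpow_neg h1.le (((N : ℝ) - 2) / 2), rpow_neg h2.le (((N : ℝ) - 2) / 2)]
  have p1 : 0 < l1 ^ (((N : ℝ) - 2) / 2) := by positivity
  have p2 : 0 < l2 ^ (((N : ℝ) - 2) / 2) := by positivity
  field_simp

end Bubble

theorem truncated_bubble_estimates (N : ℕ) (hN : 3 ≤ N) :
    ∃ C > (0 : ℝ), ∃ R₀ ≥ (1 : ℝ), ∃ lam₀ : ℝ, 0 < lam₀ ∧ lam₀ < 1 ∧
      ∀ R ≥ R₀, ∀ l1 l2 : ℝ, 0 < l1 → 0 < l2 → l1 / l2 ≤ lam₀ →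
        (Real.sqrt (∫ x, ‖fderiv ℝ (fun y => VR N R l1 l2 y - Wl N l1 y) x‖ ^ 2) ≤
            C * R ^ (-(((N : ℝ) - 2) / 2)) * (l1 / l2) ^ (((N : ℝ) - 2) / 4)) ∧
        (∀ x, |VR N R l1 l2 x - Wl N l1 x| ≤
            C * R ^ (-((N : ℝ) - 2)) * l2 ^ (-(((N : ℝ) - 2) / 2))) ∧
        (∫ x, |VR N R l1 l2 x|) ≤
            C * R ^ 2 * l2 ^ (((N : ℝ) + 2) / 2) * (l1 / l2) ^ ((N : ℝ) / 2) := by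
  have hK := bubble_denominator_pos hN
  have hA := sphereArea_nonneg N
  set K := (N : ℝ) * ((N : ℝ) - 2) with hKdef
  set A := sphereArea N
  set c₁ := √(((N : ℝ) - 2) * K ^ ((N : ℝ) - 2) * A)
  set c₂ := K ^ (((N : ℝ) - 2) / 2)
  set c₃ := c₂ * A / 2
  have hc₁ : 0 ≤ c₁ := by positivity
  have hc₂ : 0 < c₂ := by positivity
  have hc₃ : 0 ≤ c₃ := by positivity
  refine ⟨c₁ + c₂ + c₃, by positivity, 1, le_rfl, 1 / 2, by norm_num, by norm_num, ?_⟩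
  intro R hR l1 l2 h1 h2 _
  have hR0 : 0 < R := by linarith
  refine ⟨?_, fun x => ?_, ?_⟩
  · refine (sqrt_integral_sq_norm_fderiv_le hN hR0 h1 h2).trans ?_
    gcongr
    linarith
  · refine ((abs_VR_sub_Wl_le hN hR0 h1 h2 x).trans (zeta_le hN hR0 h1 h2)).trans ?_
    gcongr
    linarith
  · have e : (l1 * K) ^ (((N : ℝ) - 2) / 2) * (A * (R ^ 2 * (l1 * l2) / 2)) =
        c₃ * R ^ 2 * l2 ^ (((N : ℝ) + 2) / 2) * (l1 / l2) ^ ((N : ℝ) / 2) := by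
      rw [mul_rpow h1.le hK.le, div_rpow h1.le h2.le,
        show ((N : ℝ) + 2) / 2 = (N : ℝ) / 2 + 1 by ring, rpow_add_one h2.ne',
        show (N : ℝ) / 2 = ((N : ℝ) - 2) / 2 + 1 by ring, rpow_add_one h1.ne',
        rpow_add_one h2.ne']
      have p2 : 0 < l2 ^ (((N : ℝ) - 2) / 2) := by positivity
      simp only [c₃, c₂]
      field_simp
    refine ((integral_abs_VR_le hN hR0 h1 h2).trans_eq e).trans ?_
    gcongr
    linarith
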